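/- arXiv:1803.08906 — 2 statements merged into one kernel-verified Lean document; each statement's English description precedes it below -/
import Mathlib

section
/- Let X and Y be algebraic varieties over an algebraically closed field K and let C ⊆ X and D ⊆ Y be constructible subsets. Let C₀ and D₀ denote their sets of closed points. Then C₀ × D₀ is contained in the set of closed points of the K-fibered product X ×_K Y, and, equipping C₀ × D₀ ⊆ X ×_K Y with the Zariski subspace topology, one has dim(C₀ × D₀) = dim(C₀) + dim(D₀). -/
open AlgebraicGeometry CategoryTheory CategoryTheory.Limits Topology

noncomputable section

namespace GOE

/-- A subset of a topological space is constructible if it is a finite union of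
locally closed subsets. -/
def IsConstr {X : Type} [TopologicalSpace X] (C : Set X) : Prop :=
  ∃ (n : ℕ) (U Z : Fin n → Set X), (∀ i, IsOpen (U i)) ∧ (∀ i, IsClosed (Z i)) ∧
    C = ⋃ i, U i ∩ Z i

/-- The spectrum of the field `K`, as a scheme. -/
abbrev SpecK (K : Type) [Field K] : Scheme := Spec (CommRingCat.of K)

open scoped TensorProduct

theorem natCast_le_krullDim_iff {α : Type*} [Preorder α] {n : ℕ} :
    n ≤ Order.krullDim α ↔ ∃ f : Fin (n + 1) → α, StrictMono f := by
  rw [Order.le_krullDim_iff]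
  refine ⟨?_, fun ⟨f, hf⟩ ↦ ⟨⟨n, f, fun i ↦ hf i.castSucc_lt_succ⟩, rfl⟩⟩
  rintro ⟨l, rfl⟩
  exact ⟨l, l.strictMono⟩

theorem ringKrullDim_eq_of_isIntegral_of_injective {R S : Type*} [CommRing R] [CommRing S]
    [Algebra R S] [Algebra.IsIntegral R S] (h : Function.Injective (algebraMap R S)) :
    ringKrullDim S = ringKrullDim R := by
  refine le_antisymm (Order.krullDim_le_of_strictMono (PrimeSpectrum.comap (algebraMap R S))
    fun P Q hPQ ↦ Ideal.IsIntegral.comap_lt_comap hPQ) (iSup_le fun l ↦ ?_)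
  obtain ⟨Q, hQ, hQl⟩ := Ideal.exists_ideal_over_prime_of_isIntegral l.head.asIdeal (⊥ : Ideal S)
    (by rw [← RingHom.ker_eq_comap_bot, (RingHom.injective_iff_ker_eq_bot _).mp h]; exact bot_le)
  have : Q.LiesOver l.head.asIdeal := ⟨hQl.2.symm⟩
  have := hQl.1
  obtain ⟨L, hL, -⟩ := Ideal.exists_ltSeries_of_hasGoingUp l Q
  exact hL ▸ Order.LTSeries.length_le_krullDim L

theorem exists_ringKrullDim_eq_and_trdeg_eq (K A : Type*) [Field K] [CommRing A] [IsDomain A]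
    [Algebra K A] [Algebra.FiniteType K A] :
    ∃ s : ℕ, ringKrullDim A = s ∧ Algebra.trdeg K A = s := by
  obtain ⟨s, g, hg, hgi⟩ := exists_integral_inj_algHom_of_fg K A
  algebraize [g.toRingHom]
  have : FaithfulSMul (MvPolynomial (Fin s) K) A := (faithfulSMul_iff_algebraMap_injective _ _).2 hg
  have : IsScalarTower K (MvPolynomial (Fin s) K) A := .of_algHom g
  refine ⟨s, ?_, ?_⟩
  · rw [ringKrullDim_eq_of_isIntegral_of_injective (R := MvPolynomial (Fin s) K) hg,
      MvPolynomial.ringKrullDim_of_isNoetherianRing]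
    simp
  · have h := lift_trdeg_add_eq K (MvPolynomial (Fin s) K) A
    rw [trdeg_eq_zero (R := MvPolynomial (Fin s) K) (A := A), MvPolynomial.trdeg_of_isDomain] at h
    simpa using h.symm

theorem ringKrullDim_localizationAway (K : Type*) {A : Type*} [Field K] [CommRing A] [IsDomain A]
    [Algebra K A] [Algebra.FiniteType K A] {f : A} (hf : f ≠ 0) :
    ringKrullDim (Localization.Away f) = ringKrullDim A := by
  have hM : Submonoid.powers f ≤ nonZeroDivisors A := powers_le_nonZeroDivisors_of_noZeroDivisors hf
  have : IsDomain (Localization.Away f) := IsLocalization.isDomain_localization hM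
  have : Algebra.FiniteType A (Localization.Away f) :=
    IsLocalization.finiteType_of_monoid_fg (.powers f) _
  have : Algebra.FiniteType K (Localization.Away f) := .trans (S := A) ‹_› ‹_›
  have : FaithfulSMul A (Localization.Away f) :=
    (faithfulSMul_iff_algebraMap_injective _ _).2 (IsLocalization.injective _ hM)
  have := IsLocalization.isAlgebraic (S := Localization.Away f) (Submonoid.powers f)
  obtain ⟨s, hs, hs'⟩ := exists_ringKrullDim_eq_and_trdeg_eq K A
  obtain ⟨t, ht, ht'⟩ := exists_ringKrullDim_eq_and_trdeg_eq K (Localization.Away f)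
  have h := trdeg_add_eq K A (A := Localization.Away f)
  rw [trdeg_eq_zero (R := A) (A := Localization.Away f), hs', ht', add_zero] at h
  rw [hs, ht, Nat.cast_inj.mp h]

theorem ringKrullDim_tensorProduct (K A B : Type*) [Field K] [CommRing A] [CommRing B]
    [Nontrivial A] [Nontrivial B] [Algebra K A] [Algebra K B] [Algebra.FiniteType K A]
    [Algebra.FiniteType K B] :
    ringKrullDim (A ⊗[K] B) = ringKrullDim A + ringKrullDim B := by
  obtain ⟨s, g, hg, hgi⟩ := exists_integral_inj_algHom_of_fg K A
  obtain ⟨t, h, hh, hhi⟩ := exists_integral_inj_algHom_of_fg K B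
  have e₁ : ringKrullDim A = s := by
    algebraize [g.toRingHom]
    rw [ringKrullDim_eq_of_isIntegral_of_injective (R := MvPolynomial (Fin s) K) hg,
      MvPolynomial.ringKrullDim_of_isNoetherianRing]
    simp
  have e₂ : ringKrullDim B = t := by
    algebraize [h.toRingHom]
    rw [ringKrullDim_eq_of_isIntegral_of_injective (R := MvPolynomial (Fin t) K) hh,
      MvPolynomial.ringKrullDim_of_isNoetherianRing]
    simp
  let φ := Algebra.TensorProduct.map g h
  have hφ : Function.Injective φ := TensorProduct.map_injective_of_flat_flat _ _ hg hh
  have hφi : φ.toRingHom.IsIntegral := by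
    have hl (a : A) : φ.toRingHom.IsIntegralElem (a ⊗ₜ 1) := by
      obtain ⟨p, hp, hpa⟩ := hgi a
      refine ⟨p.map Algebra.TensorProduct.includeLeftRingHom, hp.map _, ?_⟩
      rw [Polynomial.eval₂_map]
      have : φ.toRingHom.comp Algebra.TensorProduct.includeLeftRingHom =
          (Algebra.TensorProduct.includeLeftRingHom (B := B)).comp g.toRingHom := by
        exact RingHom.ext fun x ↦ by simp [φ]
      rw [this]
      exact (Polynomial.hom_eval₂ p g.toRingHom Algebra.TensorProduct.includeLeftRingHom a).symm.trans
        (by rw [show p.eval₂ g.toRingHom a = 0 from hpa, map_zero])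
    have hr (b : B) : φ.toRingHom.IsIntegralElem (1 ⊗ₜ b) := by
      obtain ⟨p, hp, hpb⟩ := hhi b
      let ιr := (Algebra.TensorProduct.includeRight (R := K) (A := A) (B := B)).toRingHom
      let ιs := (Algebra.TensorProduct.includeRight (R := K) (A := MvPolynomial (Fin s) K)
        (B := MvPolynomial (Fin t) K)).toRingHom
      refine ⟨p.map ιs, hp.map _, ?_⟩
      rw [Polynomial.eval₂_map]
      have : φ.toRingHom.comp ιs = ιr.comp h.toRingHom := by
        exact RingHom.ext fun x ↦ by simp [φ, ιr, ιs]
      rw [this]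
      exact (Polynomial.hom_eval₂ p h.toRingHom ιr b).symm.trans
        (by rw [show p.eval₂ h.toRingHom b = 0 from hpb, map_zero])
    intro z
    induction z with
    | zero => exact φ.toRingHom.isIntegralElem_zero
    | add x y hx hy => exact hx.add φ.toRingHom hy
    | tmul a b =>
      rw [← mul_one a, ← one_mul b, ← Algebra.TensorProduct.tmul_mul_tmul]
      exact (hl a).mul φ.toRingHom (hr b)
  algebraize [φ.toRingHom]
  rw [ringKrullDim_eq_of_isIntegral_of_injective
      (R := MvPolynomial (Fin s) K ⊗[K] MvPolynomial (Fin t) K) hφ,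
    ringKrullDim_eq_of_ringEquiv (MvPolynomial.tensorEquivSum K (Fin s) (Fin t) K).toRingEquiv,
    MvPolynomial.ringKrullDim_of_isNoetherianRing, e₁, e₂]
  simp

theorem exists_prime_le_ringKrullDim_quotient {R : Type*} [CommRing R] {n : ℕ}
    (h : n ≤ ringKrullDim R) : ∃ P ∈ minimalPrimes R, n ≤ ringKrullDim (R ⧸ P) := by
  obtain ⟨l, hl⟩ := natCast_le_krullDim_iff.1 h
  obtain ⟨P, hP, hPl⟩ := Ideal.exists_minimalPrimes_le (I := ⊥) (J := (l 0).asIdeal) bot_le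
  refine ⟨P, hP, ?_⟩
  rw [ringKrullDim_quotient]
  exact natCast_le_krullDim_iff.2
    ⟨fun i ↦ ⟨l i, hPl.trans (hl.monotone (Fin.zero_le i))⟩, fun i j hij ↦ hl hij⟩

theorem IsConstr.preimage {X Y : Type} [TopologicalSpace X] [TopologicalSpace Y] {C : Set Y}
    (hC : IsConstr C) {f : X → Y} (hf : Continuous f) : IsConstr (f ⁻¹' C) := by
  obtain ⟨n, U, Z, hU, hZ, rfl⟩ := hC
  exact ⟨n, fun i ↦ f ⁻¹' U i, fun i ↦ f ⁻¹' Z i, fun i ↦ (hU i).preimage hf,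
    fun i ↦ (hZ i).preimage hf, by simp⟩

theorem IsConstr.inter {X : Type} [TopologicalSpace X] {C D : Set X}
    (hC : IsConstr C) (hD : IsConstr D) : IsConstr (C ∩ D) := by
  obtain ⟨n, U, Z, hU, hZ, rfl⟩ := hC
  obtain ⟨m, V, T, hV, hT, rfl⟩ := hD
  refine ⟨n * m, fun k ↦ U (finProdFinEquiv.symm k).1 ∩ V (finProdFinEquiv.symm k).2,
    fun k ↦ Z (finProdFinEquiv.symm k).1 ∩ T (finProdFinEquiv.symm k).2,
    fun k ↦ (hU _).inter (hV _), fun k ↦ (hZ _).inter (hT _), ?_⟩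
  rw [Set.iUnion_inter_iUnion, finProdFinEquiv.symm.surjective.iUnion_comp
    fun k : Fin n × Fin m ↦ (U k.1 ∩ V k.2) ∩ (Z k.1 ∩ T k.2), Set.iUnion_prod']
  simp_rw [Set.inter_inter_inter_comm]

theorem IsConstr.mem_of_isGenericPoint_closure {X : Type} [TopologicalSpace X] {C F : Set X}
    (hC : IsConstr C) (hF : IsIrreducible F) (hFC : F ⊆ C) {x : X}
    (hx : IsGenericPoint x (closure F)) : x ∈ C := by
  classical
  obtain ⟨n, U, Z, hU, hZ, rfl⟩ := hC
  obtain ⟨T, hT, hFT⟩ := isIrreducible_iff_sUnion_isClosed.1 hF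
    (Finset.univ.image fun i ↦ closure (F ∩ (U i ∩ Z i))) (by simp) fun y hy ↦ by
      obtain ⟨i, hi⟩ := Set.mem_iUnion.1 (hFC hy)
      exact ⟨_, Finset.mem_image_of_mem _ (Finset.mem_univ i), subset_closure ⟨hy, hi⟩⟩
  simp only [Finset.mem_image, Finset.mem_univ, true_and] at hT
  obtain ⟨i, rfl⟩ := hT
  obtain ⟨y, hyF, hyU, -⟩ := closure_nonempty_iff.1 (hF.nonempty.mono hFT)
  refine Set.mem_iUnion.2 ⟨i, (hx.mem_open_set_iff (hU i)).2 ⟨y, subset_closure hyF, hyU⟩,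
    (hx.mem_closed_set_iff (hZ i)).2 ?_⟩
  exact (closure_minimal hFT isClosed_closure).trans
    (closure_minimal (fun z hz ↦ hz.2.2) (hZ i))

theorem IsConstr.closure_closure_singleton_inter_closedPoints {X : Type} [TopologicalSpace X]
    [JacobsonSpace X] {C : Set X} (hC : IsConstr C) {x : X} (hx : x ∈ C) :
    closure (closure {x} ∩ (C ∩ closedPoints X)) = closure {x} := by
  obtain ⟨n, U, Z, hU, hZ, rfl⟩ := hC
  obtain ⟨i, hi⟩ := Set.mem_iUnion.1 hx
  have hl : IsLocallyClosed (closure {x} ∩ (U i ∩ Z i)) :=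
    isClosed_closure.isLocallyClosed.inter ((hU i).isLocallyClosed.inter (hZ i).isLocallyClosed)
  refine subset_antisymm (closure_minimal Set.inter_subset_left isClosed_closure) ?_
  calc closure {x} ⊆ closure (closure {x} ∩ (U i ∩ Z i)) :=
        closure_mono (Set.singleton_subset_iff.2 ⟨subset_closure rfl, hi⟩)
    _ = closure (closure {x} ∩ (U i ∩ Z i) ∩ closedPoints X) :=
        (JacobsonSpace.closure_inter_closedPoints_eq_closure hl).symm
    _ ⊆ closure (closure {x} ∩ ((⋃ i, U i ∩ Z i) ∩ closedPoints X)) :=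
        closure_mono fun y hy ↦ ⟨hy.1.1, Set.mem_iUnion.2 ⟨i, hy.1.2⟩, hy.2⟩

theorem _root_.IsIrreducible.preimage_subtypeVal {X : Type*} [TopologicalSpace X] {S F : Set X}
    (hF : IsIrreducible (F ∩ S)) : IsIrreducible (Subtype.val ⁻¹' F : Set S) := by
  obtain ⟨x, hx⟩ := hF.nonempty
  refine ⟨⟨⟨x, hx.2⟩, hx.1⟩, ?_⟩
  rintro _ _ ⟨u, hu, rfl⟩ ⟨v, hv, rfl⟩ ⟨x, hx, hxu⟩ ⟨y, hy, hyv⟩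
  obtain ⟨z, hz, hzuv⟩ := hF.2 u v hu hv ⟨x, ⟨hx, x.2⟩, hxu⟩ ⟨y, ⟨hy, y.2⟩, hyv⟩
  exact ⟨⟨z, hz.2⟩, hz.1, hzuv⟩

theorem IsConstr.natCast_le_topologicalKrullDim_iff {X : Type} [TopologicalSpace X]
    [JacobsonSpace X] [QuasiSober X] {C : Set X} (hC : IsConstr C) {n : ℕ} :
    n ≤ topologicalKrullDim ↥(C ∩ closedPoints X) ↔
      ∃ c : Fin (n + 1) → X, (∀ i, c i ∈ C) ∧ ∀ i j, i < j → c j ⤳ c i ∧ ¬ c i ⤳ c j := by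
  rw [topologicalKrullDim, natCast_le_krullDim_iff]
  constructor
  · rintro ⟨f, hf⟩
    let g i := TopologicalSpace.IrreducibleCloseds.map _ continuous_subtype_val (f i)
    have hg : StrictMono g := (TopologicalSpace.IrreducibleCloseds.map_strictMono_of_isInducing
      IsInducing.subtypeVal).comp hf
    have hc i := (g i).isIrreducible.isGenericPoint_genericPoint (g i).isClosed
    refine ⟨fun i ↦ (g i).isIrreducible.genericPoint, fun i ↦ ?_, fun i j hij ↦ ?_⟩
    · exact hC.mem_of_isGenericPoint_closure
        ((f i).isIrreducible.image _ continuous_subtype_val.continuousOn)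
        (by rintro _ ⟨y, -, rfl⟩; exact y.2.1) (hc i)
    · refine ⟨(hc j).specializes ((hg hij).le (hc i).mem), fun h ↦ ((hg hij).not_ge ?_)⟩
      exact ((hc j).mem_closed_set_iff (g i).isClosed).1 (h.mem_closed (g i).isClosed (hc i).mem)
  · rintro ⟨c, hcC, hc⟩
    have h i := hC.closure_closure_singleton_inter_closedPoints (hcC i)
    refine ⟨fun i ↦ ⟨Subtype.val ⁻¹' closure {c i}, .preimage_subtypeVal ?_,
      isClosed_closure.preimage continuous_subtype_val⟩, fun i j hij ↦ ?_⟩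
    · rw [← isIrreducible_iff_closure, h i]
      exact isIrreducible_singleton.closure
    · refine lt_of_le_not_ge ?_ fun hle ↦ (hc i j hij).2 ?_
      · exact fun y hy ↦ specializes_iff_closure_subset.1 (hc i j hij).1 hy
      · rw [specializes_iff_closure_subset, ← h j]
        exact closure_minimal
          (fun y hy ↦ hle (show (⟨y, hy.2⟩ : ↥(C ∩ closedPoints X)) ∈ _ from hy.1))
          isClosed_closure

theorem add_le_of_forall_natCast_add_le {a b c : WithBot ℕ∞}
    (h : ∀ k l : ℕ, k ≤ a → l ≤ b → (k + l : ℕ) ≤ c) : a + b ≤ c := by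
  induction a with
  | bot => simp
  | coe a =>
  induction b with
  | bot => simp
  | coe b =>
  induction c with
  | bot => simpa using h 0 0 (by simp) (by simp)
  | coe c =>
  norm_cast at h ⊢
  induction c with
  | top => exact le_top
  | coe c =>
  induction a with
  | top => exact absurd (h (c + 1) 0 le_top zero_le) (by norm_cast; lia)
  | coe a =>
  induction b with
  | top => exact absurd (h 0 (c + 1) zero_le le_top) (by norm_cast; lia)
  | coe b => exact_mod_cast h a b le_rfl le_rfl

theorem le_of_forall_natCast_le {a b : WithBot ℕ∞} (h : ∀ n : ℕ, n ≤ a → n ≤ b) : a ≤ b := by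
  simpa using add_le_of_forall_natCast_add_le (b := 0) fun k l hk hl ↦ by
    obtain rfl : l = 0 := by simpa using hl
    exact h k hk

theorem exists_chart {K : Type} [Field K] {X : Scheme} (s : X ⟶ SpecK K) [LocallyOfFiniteType s]
    (x : X) : ∃ (A : Type) (_ : CommRing A) (_ : Algebra K A) (i : Spec (.of A) ⟶ X),
      Algebra.FiniteType K A ∧ IsOpenImmersion i ∧
      i ≫ s = Spec.map (CommRingCat.ofHom (algebraMap K A)) ∧ x ∈ Set.range i := by
  obtain ⟨R, i, hi, hx⟩ : ∃ (R : CommRingCat) (i : Spec R ⟶ X), IsOpenImmersion i ∧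
      x ∈ Set.range i := by
    obtain ⟨y, hy⟩ := X.affineCover.covers x
    exact ⟨_, X.affineCover.f (X.affineCover.idx x), X.affineCover.map_prop _, y, hy⟩
  obtain ⟨φ, hφ⟩ := Spec.map_surjective (i ≫ s)
  let _ : Algebra K R := φ.hom.toAlgebra
  refine ⟨R, inferInstance, inferInstance, i, ?_, hi, hφ.symm, hx⟩
  have : LocallyOfFiniteType (Spec.map φ) := hφ ▸ inferInstance
  exact (HasRingHomProperty.Spec_iff (P := @LocallyOfFiniteType)).1 this

section Chart

variable {A : Type} [CommRing A] {X : Scheme} (i : Spec (.of A) ⟶ X)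
  [IsOpenImmersion i]

theorem specializes_chart_iff (p q : PrimeSpectrum A) :
    (i p : X) ⤳ i q ↔ p ≤ q :=
  i.isOpenEmbedding.isInducing.specializes_iff.trans (PrimeSpectrum.le_iff_specializes p q).symm

theorem IsConstr.ringKrullDim_quotient_le (K : Type) [Field K] [Algebra K A]
    [Algebra.FiniteType K A] [JacobsonSpace X] {C : Set X} (hC : IsConstr C) {p : PrimeSpectrum A} (hp : i p ∈ C) :
    ringKrullDim (A ⧸ p.asIdeal) ≤ topologicalKrullDim ↥(C ∩ closedPoints X) := by
  refine le_of_forall_natCast_le fun n hn ↦ hC.natCast_le_topologicalKrullDim_iff.2 ?_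
  obtain ⟨m, U, Z, hU, hZ, rfl⟩ := hC
  obtain ⟨j, hpU, hpZ⟩ := Set.mem_iUnion.1 hp
  obtain ⟨_, ⟨_, ⟨f, rfl⟩, rfl⟩, hpf, hf⟩ :=
    PrimeSpectrum.isBasis_basic_opens.exists_subset_of_mem_open (u := i ⁻¹' U j) hpU
      ((hU j).preimage i.continuous)
  let f' := Ideal.Quotient.mk p.asIdeal f
  have hf' : f' ≠ 0 := fun h ↦ hpf (Ideal.Quotient.eq_zero_iff_mem.1 h)
  rw [← ringKrullDim_localizationAway K hf'] at hn
  obtain ⟨l, hl⟩ := natCast_le_krullDim_iff.1 hn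
  let φ := (algebraMap (A ⧸ p.asIdeal) (Localization.Away f')).comp (Ideal.Quotient.mk p.asIdeal)
  have hφ : StrictMono (PrimeSpectrum.comap φ) := by
    refine Monotone.strictMono_of_injective (fun _ _ h ↦ Ideal.comap_mono h) ?_
    rw [PrimeSpectrum.comap_comp]
    exact (PrimeSpectrum.comap_injective_of_surjective _ Ideal.Quotient.mk_surjective).comp
      (PrimeSpectrum.localization_comap_injective _ (Submonoid.powers f'))
  have hpφ Q : p ≤ PrimeSpectrum.comap φ Q := fun a ha ↦ by
    simp [φ, Ideal.Quotient.eq_zero_iff_mem.2 ha]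
  have hfφ Q : f ∉ (PrimeSpectrum.comap φ Q).asIdeal := fun h ↦
    Q.2.ne_top (Ideal.eq_top_of_isUnit_mem _ h (IsLocalization.Away.algebraMap_isUnit f'))
  refine ⟨fun k ↦ i (PrimeSpectrum.comap φ (l k.rev)), fun k ↦ Set.mem_iUnion.2 ⟨j, ?_, ?_⟩,
    fun k k' hk ↦ ?_⟩
  · exact hf (hfφ _)
  · exact ((specializes_chart_iff i _ _).2 (hpφ _)).mem_closed (hZ j) hpZ
  · simp_rw [specializes_chart_iff, ← lt_iff_le_not_ge]
    exact hφ (hl (Fin.rev_lt_rev.2 hk))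

theorem exists_chart_le_ringKrullDim_quotient {n : ℕ} {c : Fin (n + 1) → X}
    (hc : ∀ k l, k < l → c l ⤳ c k ∧ ¬ c k ⤳ c l) (h0 : c 0 ∈ Set.range i) :
    ∃ p : PrimeSpectrum A, i p = c (Fin.last n) ∧ n ≤ ringKrullDim (A ⧸ p.asIdeal) := by
  have hr k : c k ∈ Set.range i := by
    obtain rfl | hk := eq_or_ne k 0
    · exact h0
    · exact (hc 0 k (Fin.pos_iff_ne_zero.2 hk)).1.mem_open i.isOpenEmbedding.isOpen_range h0
  choose q hq using hr
  change Fin (n + 1) → PrimeSpectrum A at q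
  replace hc k l (h : k < l) : q l < q k := by
    simpa only [← hq, specializes_chart_iff, lt_iff_le_not_ge] using hc k l h
  refine ⟨q (Fin.last n), hq _, ?_⟩
  rw [ringKrullDim_quotient]
  refine natCast_le_krullDim_iff.2
    ⟨fun k ↦ ⟨q k.rev, ?_⟩, fun k l h ↦ hc _ _ (Fin.rev_lt_rev.2 h)⟩
  change q (Fin.last n) ≤ q k.rev
  obtain h | h := (Fin.le_last k.rev).eq_or_lt
  · exact h ▸ le_rfl
  · exact (hc _ _ h).le

end Chart

section TensorProduct

variable (K : Type*) {A B : Type*} [Field K] [CommRing A] [CommRing B] [Algebra K A] [Algebra K B]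

theorem ringKrullDim_quotient_tensorProduct_le [Algebra.FiniteType K A] [Algebra.FiniteType K B]
    (P : PrimeSpectrum (A ⊗[K] B)) :
    ringKrullDim (A ⊗[K] B ⧸ P.asIdeal) ≤
      ringKrullDim (A ⧸ (P.comap Algebra.TensorProduct.includeLeftRingHom).asIdeal) +
      ringKrullDim (B ⧸ (P.comap
        (Algebra.TensorProduct.includeRight (R := K) (A := A)).toRingHom).asIdeal) := by
  rw [← ringKrullDim_tensorProduct K]
  let φ : A ⧸ (P.comap Algebra.TensorProduct.includeLeftRingHom).asIdeal →ₐ[K]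
      A ⊗[K] B ⧸ P.asIdeal :=
    Ideal.quotientMapₐ _ Algebra.TensorProduct.includeLeft le_rfl
  let ψ : B ⧸ (P.comap
      (Algebra.TensorProduct.includeRight (R := K) (A := A)).toRingHom).asIdeal →ₐ[K] A ⊗[K] B ⧸ P.asIdeal :=
    Ideal.quotientMapₐ _ Algebra.TensorProduct.includeRight le_rfl
  refine ringKrullDim_le_of_surjective (Algebra.TensorProduct.productMap φ ψ).toRingHom fun z ↦ ?_
  change ∃ w, Algebra.TensorProduct.productMap φ ψ w = z
  obtain ⟨z, rfl⟩ := Ideal.Quotient.mk_surjective z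
  induction z with
  | zero => exact ⟨0, by rw [map_zero, map_zero]⟩
  | add x y hx hy =>
    obtain ⟨x', hx⟩ := hx
    obtain ⟨y', hy⟩ := hy
    exact ⟨x' + y', by rw [map_add, hx, hy, map_add]⟩
  | tmul a b =>
    refine ⟨Ideal.Quotient.mk _ a ⊗ₜ Ideal.Quotient.mk _ b, ?_⟩
    rw [Algebra.TensorProduct.productMap_apply_tmul]
    change Ideal.Quotient.mk P.asIdeal (a ⊗ₜ 1) * Ideal.Quotient.mk P.asIdeal (1 ⊗ₜ b) = _
    simp [← map_mul]

theorem tmul_mem_nonZeroDivisors {a : A} {b : B} (ha : a ∈ nonZeroDivisors A)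
    (hb : b ∈ nonZeroDivisors B) : a ⊗ₜ[K] b ∈ nonZeroDivisors (A ⊗[K] B) := by
  have h := TensorProduct.map_injective_of_flat_flat (LinearMap.mulLeft K a) (LinearMap.mulLeft K b)
    (isRegular_iff_mem_nonZeroDivisors.2 ha).left (isRegular_iff_mem_nonZeroDivisors.2 hb).left
  have e : TensorProduct.map (LinearMap.mulLeft K a) (LinearMap.mulLeft K b) =
      LinearMap.mulLeft K (a ⊗ₜ[K] b) := by
    ext
    simp
  rw [e] at h
  exact mem_nonZeroDivisors_iff_left.2 fun x hx ↦ h (by simpa using hx)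

theorem exists_prime_natCast_add_le_ringKrullDim_quotient [Algebra.FiniteType K A]
    [Algebra.FiniteType K B] (p : PrimeSpectrum A) (q : PrimeSpectrum B) {k l : ℕ}
    (hk : k ≤ ringKrullDim (A ⧸ p.asIdeal)) (hl : l ≤ ringKrullDim (B ⧸ q.asIdeal)) :
    ∃ P : PrimeSpectrum (A ⊗[K] B), P.comap Algebra.TensorProduct.includeLeftRingHom = p ∧
      P.comap (Algebra.TensorProduct.includeRight (R := K) (A := A)).toRingHom = q ∧
      (k + l : ℕ) ≤ ringKrullDim (A ⊗[K] B ⧸ P.asIdeal) := by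
  have h : (k + l : ℕ) ≤ ringKrullDim ((A ⧸ p.asIdeal) ⊗[K] (B ⧸ q.asIdeal)) := by
    rw [ringKrullDim_tensorProduct K]
    push_cast
    exact add_le_add hk hl
  obtain ⟨Q, hQ, hdim⟩ := exists_prime_le_ringKrullDim_quotient h
  have hQp : Q.IsPrime := hQ.1.1
  let φ := Algebra.TensorProduct.map (Ideal.Quotient.mkₐ K p.asIdeal)
    (Ideal.Quotient.mkₐ K q.asIdeal)
  have hφ : Function.Surjective φ :=
    TensorProduct.map_surjective Ideal.Quotient.mk_surjective Ideal.Quotient.mk_surjective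
  have hQd {x} (hx : x ∈ Q) : x ∉ nonZeroDivisors _ := fun hx' ↦
    Set.disjoint_left.1 (Ideal.disjoint_nonZeroDivisors_of_mem_minimalPrimes hQ) hx hx'
  refine ⟨⟨Q.comap φ, inferInstance⟩, ?_, ?_, ?_⟩
  · ext a
    suffices h : (Ideal.Quotient.mk p.asIdeal a ⊗ₜ[K] (1 : B ⧸ q.asIdeal) ∈ Q ↔ a ∈ p.asIdeal) by
      simpa [φ] using h
    refine ⟨fun h ↦ ?_, fun h ↦ by simp [Ideal.Quotient.eq_zero_iff_mem.2 h]⟩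
    contrapose! h
    exact fun hQ ↦ hQd hQ (tmul_mem_nonZeroDivisors K
      (mem_nonZeroDivisors_of_ne_zero (mt Ideal.Quotient.eq_zero_iff_mem.1 h)) (one_mem _))
  · ext b
    suffices h : ((1 : A ⧸ p.asIdeal) ⊗ₜ[K] Ideal.Quotient.mk q.asIdeal b ∈ Q ↔ b ∈ q.asIdeal) by
      simpa [φ] using h
    refine ⟨fun h ↦ ?_, fun h ↦ by simp [Ideal.Quotient.eq_zero_iff_mem.2 h]⟩
    contrapose! h
    exact fun hQ ↦ hQd hQ (tmul_mem_nonZeroDivisors K (one_mem _)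
      (mem_nonZeroDivisors_of_ne_zero (mt Ideal.Quotient.eq_zero_iff_mem.1 h)))
  · exact hdim.trans (ringKrullDim_le_of_surjective (Ideal.quotientMap Q φ.toRingHom le_rfl)
      (Ideal.quotientMap_surjective hφ))

end TensorProduct

theorem exists_pullback_chart {K : Type} [Field K] {X Y : Scheme} {sX : X ⟶ SpecK K}
    {sY : Y ⟶ SpecK K} {A B : Type} [CommRing A] [CommRing B] [Algebra K A] [Algebra K B]
    (i : Spec (.of A) ⟶ X) (j : Spec (.of B) ⟶ Y) [IsOpenImmersion i] [IsOpenImmersion j]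
    (hi : i ≫ sX = Spec.map (CommRingCat.ofHom (algebraMap K A)))
    (hj : j ≫ sY = Spec.map (CommRingCat.ofHom (algebraMap K B))) :
    ∃ k : Spec (.of (A ⊗[K] B)) ⟶ pullback sX sY, IsOpenImmersion k ∧
      (∀ P : PrimeSpectrum (A ⊗[K] B), pullback.fst sX sY (k P) =
        i (P.comap Algebra.TensorProduct.includeLeftRingHom)) ∧
      (∀ P : PrimeSpectrum (A ⊗[K] B), pullback.snd sX sY (k P) =
        j (P.comap (Algebra.TensorProduct.includeRight (R := K) (A := A)).toRingHom)) ∧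
      Set.range k = pullback.fst sX sY ⁻¹' Set.range i ∩ pullback.snd sX sY ⁻¹' Set.range j := by
  let m := pullback.map (Spec.map (CommRingCat.ofHom (algebraMap K A)))
    (Spec.map (CommRingCat.ofHom (algebraMap K B))) sX sY i j (𝟙 _) (by simp [hi]) (by simp [hj])
  let k := (pullbackSpecIso K A B).inv ≫ m
  have h1 : k ≫ pullback.fst sX sY = Spec.map (CommRingCat.ofHom
      Algebra.TensorProduct.includeLeftRingHom) ≫ i := by
    rw [← pullbackSpecIso_inv_fst_assoc, Category.assoc]
    exact congr(_ ≫ $(pullback.lift_fst _ _ _))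
  have h2 : k ≫ pullback.snd sX sY = Spec.map (CommRingCat.ofHom
      (Algebra.TensorProduct.includeRight (R := K) (A := A)).toRingHom) ≫ j := by
    refine Eq.trans ?_ (pullbackSpecIso_inv_snd_assoc K A B j)
    rw [Category.assoc]
    exact congr(_ ≫ $(pullback.lift_snd _ _ _))
  refine ⟨k, inferInstance, fun P ↦ congr($h1 P), fun P ↦ congr($h2 P), ?_⟩
  have : Set.range k = Set.range m := by
    simp only [k, Scheme.Hom.comp_base, TopCat.coe_comp]
    exact (Scheme.homeoOfIso (pullbackSpecIso K A B).symm).surjective.range_comp _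
  rw [this, Scheme.Pullback.range_map]

theorem mem_closedPoints_chart_iff {A : Type} [CommRing A] {X : Scheme} [JacobsonSpace X]
    (i : Spec (.of A) ⟶ X) [IsOpenImmersion i] (p : PrimeSpectrum A) :
    i p ∈ closedPoints X ↔ ringKrullDim (A ⧸ p.asIdeal) ≤ 0 := by
  refine (Set.ext_iff.1 i.isOpenEmbedding.preimage_closedPoints p).trans ?_
  change IsClosed {p} ↔ _
  rw [PrimeSpectrum.isClosed_singleton_iff_isMaximal, ← Nat.cast_zero, ← Ring.krullDimLE_iff,
    Ideal.krullDimLE_zero_quotient_iff_forall_minimalPrimes_isMaximal,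
    Ideal.minimalPrimes_eq_subsingleton_self]
  simp

/-- Proposition 2.10, parts (ii) and (iii). Let `X`, `Y` be algebraic
varieties over an algebraically closed field `K` and `C ⊆ X`, `D ⊆ Y` constructible
subsets, with sets of closed points `C₀`, `D₀`. Then (the canonical copy of) `C₀ × D₀`
inside the fibered product `X ×_K Y` consists of closed points, and its Krull dimension
for the Zariski topology is `dim C₀ + dim D₀`. -/
theorem dim_prod_closedPoints
    (K : Type) [Field K] [IsAlgClosed K] (X Y : Scheme)
    (sX : X ⟶ SpecK K) (sY : Y ⟶ SpecK K)
    (hXft : LocallyOfFiniteType sX) (hXqc : QuasiCompact sX)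
    (hYft : LocallyOfFiniteType sY) (hYqc : QuasiCompact sY)
    (C : Set X) (D : Set Y) (hC : IsConstr C) (hD : IsConstr D) :
    let W : Scheme := pullback sX sY
    let S : Set ↥W := {w : ↥W |
        (pullback.fst sX sY).base w ∈ C ∩ closedPoints X ∧
        (pullback.snd sX sY).base w ∈ D ∩ closedPoints Y}
    S ⊆ closedPoints ↥W ∧
    topologicalKrullDim ↥S =
      topologicalKrullDim ↥(C ∩ closedPoints X) +
        topologicalKrullDim ↥(D ∩ closedPoints Y) := by
  intro W S
  have : JacobsonSpace X := LocallyOfFiniteType.jacobsonSpace sX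
  have : JacobsonSpace Y := LocallyOfFiniteType.jacobsonSpace sY
  have : JacobsonSpace W := LocallyOfFiniteType.jacobsonSpace (pullback.fst sX sY)
  have hchart (w : W) : ∃ (A B : Type) (_ : CommRing A) (_ : CommRing B) (_ : Algebra K A)
      (_ : Algebra K B) (i : Spec (.of A) ⟶ X) (j : Spec (.of B) ⟶ Y)
      (k : Spec (.of (A ⊗[K] B)) ⟶ W), Algebra.FiniteType K A ∧ Algebra.FiniteType K B ∧
      IsOpenImmersion i ∧ IsOpenImmersion j ∧ IsOpenImmersion k ∧
      (∀ P : PrimeSpectrum (A ⊗[K] B), pullback.fst sX sY (k P) =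
        i (P.comap Algebra.TensorProduct.includeLeftRingHom)) ∧
      (∀ P : PrimeSpectrum (A ⊗[K] B), pullback.snd sX sY (k P) =
        j (P.comap (Algebra.TensorProduct.includeRight (R := K) (A := A)).toRingHom)) ∧
      w ∈ Set.range k := by
    obtain ⟨A, _, _, i, _, _, hi, hwi⟩ := exists_chart sX (pullback.fst sX sY w)
    obtain ⟨B, _, _, j, _, _, hj, hwj⟩ := exists_chart sY (pullback.snd sX sY w)
    obtain ⟨k, hk, hk₁, hk₂, hk₃⟩ := exists_pullback_chart i j hi hj
    exact ⟨A, B, _, _, _, _, i, j, k, ‹_›, ‹_›, ‹_›, ‹_›, hk, hk₁, hk₂, hk₃ ▸ ⟨hwi, hwj⟩⟩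
  have hSW : S ⊆ closedPoints W := by
    rintro w ⟨⟨-, hw₁⟩, -, hw₂⟩
    obtain ⟨A, B, _, _, _, _, i, j, k, _, _, _, _, _, hk₁, hk₂, P, rfl⟩ := hchart w
    replace hw₁ := (mem_closedPoints_chart_iff i _).1 (hk₁ P ▸ hw₁)
    replace hw₂ := (mem_closedPoints_chart_iff j _).1 (hk₂ P ▸ hw₂)
    exact (mem_closedPoints_chart_iff k P).2 ((ringKrullDim_quotient_tensorProduct_le K P).trans
      ((add_le_add hw₁ hw₂).trans_eq (zero_add 0)))
  let E : Set W := pullback.fst sX sY ⁻¹' C ∩ pullback.snd sX sY ⁻¹' D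
  have hE : IsConstr E := (hC.preimage (pullback.fst sX sY).continuous).inter
    (hD.preimage (pullback.snd sX sY).continuous)
  have hSE : S = E ∩ closedPoints W := by
    refine subset_antisymm (fun w hw ↦ ⟨⟨hw.1.1, hw.2.1⟩, hSW hw⟩) fun w hw ↦
      ⟨⟨hw.1.1, ?_⟩, hw.1.2, ?_⟩
    · exact Scheme.Hom.closePoints_subset_preimage_closedPoints (pullback.fst sX sY) hw.2
    · exact Scheme.Hom.closePoints_subset_preimage_closedPoints (pullback.snd sX sY) hw.2
  refine ⟨hSW, ?_⟩
  rw [hSE]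
  apply le_antisymm
  · refine le_of_forall_natCast_le fun n hn ↦ ?_
    obtain ⟨c, hcE, hc⟩ := hE.natCast_le_topologicalKrullDim_iff.1 hn
    obtain ⟨A, B, _, _, _, _, i, j, k, _, _, _, _, _, hk₁, hk₂, h0⟩ := hchart (c 0)
    obtain ⟨P, hP, hnP⟩ := exists_chart_le_ringKrullDim_quotient k hc h0
    have hPE : k P ∈ E := hP ▸ hcE _
    exact hnP.trans <| (ringKrullDim_quotient_tensorProduct_le K P).trans <| add_le_add
      (hC.ringKrullDim_quotient_le i K (hk₁ P ▸ hPE.1))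
      (hD.ringKrullDim_quotient_le j K (hk₂ P ▸ hPE.2))
  · refine add_le_of_forall_natCast_add_le fun k l hk hl ↦ ?_
    obtain ⟨c, hcC, hc⟩ := hC.natCast_le_topologicalKrullDim_iff.1 hk
    obtain ⟨d, hdD, hd⟩ := hD.natCast_le_topologicalKrullDim_iff.1 hl
    obtain ⟨A, _, _, i, _, _, hi, h0i⟩ := exists_chart sX (c 0)
    obtain ⟨B, _, _, j, _, _, hj, h0j⟩ := exists_chart sY (d 0)
    obtain ⟨p, hp, hkp⟩ := exists_chart_le_ringKrullDim_quotient i hc h0i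
    obtain ⟨q, hq, hlq⟩ := exists_chart_le_ringKrullDim_quotient j hd h0j
    obtain ⟨m, _, hm₁, hm₂, -⟩ := exists_pullback_chart i j hi hj
    obtain ⟨P, rfl, rfl, hP⟩ := exists_prime_natCast_add_le_ringKrullDim_quotient K p q hkp hlq
    have : Algebra.FiniteType K (A ⊗[K] B) := .trans (S := A) ‹_› inferInstance
    refine hP.trans (hE.ringKrullDim_quotient_le m K ⟨?_, ?_⟩)
    · rw [Set.mem_preimage, hm₁, hp]
      exact hcC _
    · rw [Set.mem_preimage, hm₂, hq]
      exact hdD _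

end GOE
end
end

section
/- Let X be an irreducible complete algebraic variety over an algebraically closed field K. Then there exists a proper closed subset H ⊊ X with the following property: whenever Y is a K-algebraic variety with dim(Y) < dim(X) and h : X → Y is a surjective K-scheme morphism, one has h(H) = Y. -/
open AlgebraicGeometry CategoryTheory CategoryTheory.Limits Topology

noncomputable section

namespace GOE

/-- Every maximal ideal of a polynomial ring in `n` variables over a field has height `n`. -/
theorem height_eq_of_isMaximal_mvPolynomial (k : Type*) [Field k] (n : ℕ)
    (m : Ideal (MvPolynomial (Fin n) k)) [m.IsMaximal] : m.height = n := by
  induction n with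
  | zero =>
    have h : ringKrullDim (MvPolynomial (Fin 0) k) = 0 := by simp
    have := Ideal.height_le_ringKrullDim_of_isPrime (I := m)
    rw [h] at this
    simpa using this
  | succ n ih =>
    let e := (MvPolynomial.finSuccEquiv k n).toRingEquiv
    let P : Ideal (Polynomial (MvPolynomial (Fin n) k)) := m.comap e.symm
    have hP : P.IsMaximal := Ideal.comap_isMaximal_of_equiv _
    have hp := Polynomial.isMaximal_comap_C_of_isJacobsonRing P
    have : P.LiesOver (P.comap Polynomial.C) := ⟨rfl⟩
    have h := Polynomial.height_eq_height_add_one (P.comap Polynomial.C) P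
    rw [ih] at h
    rw [← RingEquiv.height_comap e.symm m, h]
    simp

/-- The Krull dimension does not increase along integral extensions. -/
theorem ringKrullDim_le_of_isIntegral (R S : Type*) [CommRing R] [CommRing S] [Algebra R S]
    [Algebra.IsIntegral R S] : ringKrullDim S ≤ ringKrullDim R :=
  Order.krullDim_le_of_strictMono (PrimeSpectrum.comap (algebraMap R S))
    fun _ _ h ↦ Ideal.IsIntegral.comap_lt_comap h

/-- In an injective integral extension, every prime of finite height has a prime over it of at least
the same height. -/
theorem exists_liesOver_height_le_of_isIntegral {R S : Type*} [CommRing R] [CommRing S]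
    [Algebra R S] [Algebra.IsIntegral R S] (h_inj : Function.Injective (algebraMap R S))
    (p : Ideal R) [p.IsPrime] [p.FiniteHeight] :
    ∃ q : Ideal S, q.IsPrime ∧ q.LiesOver p ∧ p.height ≤ q.height := by
  obtain ⟨l, hl, hlen⟩ := p.exists_ltSeries_length_eq_height
  obtain ⟨P, -, hP, hPl⟩ := Ideal.exists_ideal_over_prime_of_isIntegral (S := S)
    l.head.asIdeal ⊥ (by
      rw [← RingHom.ker_eq_comap_bot, (RingHom.injective_iff_ker_eq_bot _).mp h_inj]
      exact bot_le)
  have : P.LiesOver l.head.asIdeal := ⟨hPl.symm⟩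
  obtain ⟨L, hLlen, -, hL⟩ := Ideal.exists_ltSeries_of_hasGoingUp l P
  refine ⟨L.last.asIdeal, L.last.isPrime, ⟨?_⟩, ?_⟩
  · have h := congrArg List.getLast? hL
    rw [List.getLast?_map, List.getLast?_eq_getLast_of_ne_nil L.toList_ne_nil,
      List.getLast?_eq_getLast_of_ne_nil l.toList_ne_nil] at h
    simp only [RelSeries.getLast_toList, Option.map_some, Option.some.injEq, hl] at h
    exact (congrArg PrimeSpectrum.asIdeal h).symm
  · rw [← hlen, ← hLlen, PrimeSpectrum.height_eq_orderHeight]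
    exact Order.length_le_height_last

/-- In a finitely generated algebra with irreducible spectrum, every nonempty principal open
subset of the spectrum contains a point whose height is at least the dimension. -/
theorem exists_isPrime_notMem_ringKrullDim_le_height (k A : Type*) [Field k] [CommRing A]
    [Algebra k A] [Algebra.FiniteType k A] (hN : (nilradical A).IsPrime) {f : A}
    (hf : ¬ IsNilpotent f) :
    ∃ q : Ideal A, q.IsPrime ∧ f ∉ q ∧ ringKrullDim A ≤ q.height := by
  have : Nontrivial A := ⟨f, 0, fun h ↦ hf (h ▸ IsNilpotent.zero)⟩
  obtain ⟨s, g, g_inj, g_int⟩ := exists_integral_inj_algHom_of_fg k A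
  algebraize [g.toRingHom]
  have : Algebra.IsIntegral (MvPolynomial (Fin s) k) A := ⟨g_int⟩
  have h_dim : ringKrullDim A ≤ s := by
    simpa using ringKrullDim_le_of_isIntegral (MvPolynomial (Fin s) k) A
  have h_lt := Ideal.comap_lt_comap_of_integral_mem_sdiff (R := MvPolynomial (Fin s) k)
    (le_sup_left : nilradical A ≤ nilradical A ⊔ Ideal.span {f}) (x := f)
    ⟨Ideal.mem_sup_right (Ideal.mem_span_singleton_self f), hf⟩ (Algebra.IsIntegral.isIntegral f)
  obtain ⟨p, hpJ, hpN⟩ := SetLike.exists_of_lt h_lt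
  have hp0 : p ≠ 0 := fun h ↦ hpN (h ▸ zero_mem _)
  obtain ⟨m, hm, hpm⟩ : ∃ m : Ideal (MvPolynomial (Fin s) k), m.IsMaximal ∧ p ∉ m := by
    by_contra! H
    have h_jac : p ∈ (⊥ : Ideal (MvPolynomial (Fin s) k)).jacobson :=
      Ideal.mem_sInf.mpr fun {I} hI ↦ H I hI.2
    rw [IsJacobsonRing.out inferInstance Ideal.isRadical_bot] at h_jac
    exact hp0 h_jac
  have hmh := height_eq_of_isMaximal_mvPolynomial k s m
  have : m.FiniteHeight := ⟨.inr (by simp [hmh])⟩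
  obtain ⟨q, hq, hqm, hle⟩ := exists_liesOver_height_le_of_isIntegral (S := A) g_inj m
  refine ⟨q, hq, fun hfq ↦ hpm ?_, h_dim.trans ?_⟩
  · rw [hqm.over]
    exact (sup_le (nilradical_le_prime q) ((Ideal.span_singleton_le_iff_mem q).mpr hfq)) hpJ
  · rw [hmh] at hle
    exact_mod_cast hle

/-- A nonempty constructible subset of a noetherian Jacobson space contains a closed point. -/
theorem nonempty_inter_closedPoints_of_isConstructible {Y : Type*} [TopologicalSpace Y]
    [TopologicalSpace.NoetherianSpace Y] [JacobsonSpace Y] {s : Set Y} (hs : IsConstructible s)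
    (hne : s.Nonempty) : (s ∩ closedPoints Y).Nonempty := by
  induction s, hs using IsConstructible.induction_of_isTopologicalBasis
    (fun U : TopologicalSpace.Opens Y ↦ (U : Set Y)) with
  | basis =>
    convert TopologicalSpace.isTopologicalBasis_opens
    ext U
    exact ⟨fun ⟨V, hV⟩ ↦ hV ▸ V.isOpen, fun hU ↦ ⟨⟨U, hU⟩, rfl⟩⟩
  | isCompact_basis U => exact TopologicalSpace.NoetherianSpace.isCompact _
  | sdiff U s hs =>
    exact nonempty_inter_closedPoints hne (U.isOpen.isLocallyClosed.inter
      (isOpen_biUnion fun V _ ↦ V.isOpen).isClosed_compl.isLocallyClosed)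
  | union s hs t ht ihs iht =>
    rw [Set.union_inter_distrib_right]
    exact hne.elim fun x hx ↦ hx.elim (fun h ↦ (ihs ⟨x, h⟩).inl) fun h ↦ (iht ⟨x, h⟩).inr

/-- The dimension of a scheme is the Krull dimension of its points ordered by specialization. -/
theorem scheme_topologicalKrullDim_eq_krullDim (X : Scheme) :
    topologicalKrullDim X = Order.krullDim X :=
  Order.krullDim_eq_of_orderIso irreducibleSetEquivPoints

/-- A locally quasi-finite morphism does not decrease the dimension. -/
theorem topologicalKrullDim_le_of_locallyQuasiFinite {X Y : Scheme} (f : X ⟶ Y)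
    [LocallyQuasiFinite f] : topologicalKrullDim X ≤ topologicalKrullDim Y := by
  rw [scheme_topologicalKrullDim_eq_krullDim, scheme_topologicalKrullDim_eq_krullDim]
  have h_map {x y : X} (h : x ≤ y) : f x ≤ f y := Specializes.map h f.continuous
  refine Order.krullDim_le_of_strictMono f fun x y hxy ↦
    lt_of_le_not_ge (h_map hxy.le) fun h ↦ hxy.not_ge ?_
  have h_eq : f x = f y := (Specializes.antisymm h (h_map hxy.le)).eq
  have : DiscreteTopology (f ⁻¹' {f y}) := (f.isDiscrete_preimage_singleton (f y)).to_subtype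
  have hsp : (⟨y, rfl⟩ : f ⁻¹' {f y}) ⤳ ⟨x, h_eq⟩ :=
    Topology.IsInducing.subtypeVal.specializes_iff.mp hxy.le
  exact (congrArg Subtype.val hsp.eq).le

/-- A closed subset of a proper scheme over a field is discrete if it lies in an affine open. -/
theorem isDiscrete_of_isClosed_of_subset_affineOpen {K : Type} [Field K] {X : Scheme}
    (sX : X ⟶ Spec (CommRingCat.of K)) [IsProper sX] {U : X.Opens} (hU : IsAffineOpen U)
    {F : Set X} (hF : IsClosed F) (hFU : F ⊆ U) : _root_.IsDiscrete F := by
  let I := Scheme.IdealSheafData.vanishingIdeal ⟨F, hF⟩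
  have h_range : Set.range I.subschemeι = F := by
    rw [Scheme.IdealSheafData.range_subschemeι]
    simp [I]
  have : IsAffine U := hU
  let j : I.subscheme ⟶ U := IsOpenImmersion.lift U.ι I.subschemeι (by simpa [h_range] using hFU)
  have hj : j ≫ U.ι = I.subschemeι := IsOpenImmersion.lift_fac _ _ _
  have : IsClosedImmersion (j ≫ U.ι) := hj ▸ inferInstance
  have : IsClosedImmersion j := .of_comp j U.ι
  have : IsAffine I.subscheme := isAffine_of_isAffineHom j
  have : IsFinite (I.subschemeι ≫ sX) := IsFinite.iff_isProper_and_isAffineHom.mpr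
    ⟨inferInstance, inferInstance⟩
  have hd : _root_.IsDiscrete (Set.univ : Set I.subscheme) := by
    convert (I.subschemeι ≫ sX).isDiscrete_preimage_singleton default
    ext x
    simpa using Subsingleton.elim _ _
  simpa [h_range] using hd.image I.subschemeι.isEmbedding.toIsInducing

/-- A nonempty open subset of an irreducible scheme locally of finite type over a field has full
dimension. -/
theorem topologicalKrullDim_le_of_nonempty_opens {K : Type} [Field K] {X : Scheme}
    (sX : X ⟶ Spec (CommRingCat.of K)) [LocallyOfFiniteType sX] [IrreducibleSpace X]
    (V : X.Opens) (hV : (V : Set X).Nonempty) : topologicalKrullDim X ≤ topologicalKrullDim V := by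
  rw [scheme_topologicalKrullDim_eq_krullDim, scheme_topologicalKrullDim_eq_krullDim,
    Order.krullDim_eq_iSup_coheight]
  refine iSup_le fun x ↦ ?_
  obtain ⟨A, i, hi, ⟨w, rfl⟩, -⟩ := Scheme.exists_affine_mem_range_and_range_subset
      (show x ∈ (⊤ : X.Opens) from trivial)
  obtain ⟨φ, hφ⟩ := Spec.map_surjective (i ≫ sX)
  have hft : LocallyOfFiniteType (Spec.map φ) := hφ ▸ inferInstance
  rw [HasRingHomProperty.Spec_iff (P := @LocallyOfFiniteType)] at hft
  algebraize [φ.hom]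
  have : Algebra.FiniteType K A := hft
  have hirr : IrreducibleSpace (Spec A) :=
    { toPreirreducibleSpace := ⟨by
        simpa using (PreirreducibleSpace.isPreirreducible_univ (X := X)).preimage i.isOpenEmbedding⟩
      toNonempty := ⟨w⟩ }
  have hN := PrimeSpectrum.irreducibleSpace_iff_isPrime_nilradical.mp hirr
  obtain ⟨z, hz⟩ : (i ⁻¹ᵁ V : Set (Spec A)).Nonempty := by
    obtain ⟨_, ⟨z, rfl⟩, hz⟩ := nonempty_preirreducible_inter
      i.isOpenEmbedding.isOpen_range V.isOpen ⟨_, w, rfl⟩ hV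
    exact ⟨z, hz⟩
  obtain ⟨_, ⟨a, rfl⟩, hza, haV⟩ :=
    PrimeSpectrum.isTopologicalBasis_basic_opens.exists_subset_of_mem_open hz (i ⁻¹ᵁ V).isOpen
  obtain ⟨q, hq, haq, hle⟩ := exists_isPrime_notMem_ringKrullDim_le_height K A hN (f := a)
    fun h ↦ hza (z.isPrime.isRadical.radical_le_iff.mpr bot_le h)
  let Q : Spec A := ⟨q, hq⟩
  have := w.isPrime
  have hQV : i Q ∈ V := haV haq
  let v : V.toScheme := ⟨i Q, hQV⟩
  have h1 : Order.coheight (i Q) = Order.coheight v :=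
    coheight_eq_of_isOpenImmersion (x := v) V.ι
  have h2 : Order.coheight (i Q) = Order.coheight Q := coheight_eq_of_isOpenImmersion i
  have h3 : Order.coheight (i w) = Order.coheight w := coheight_eq_of_isOpenImmersion i
  calc (Order.coheight (i w) : WithBot ℕ∞) = w.asIdeal.height := by rw [h3, idealHeight_eq_coheight]
    _ ≤ ringKrullDim A := Ideal.height_le_ringKrullDim_of_isPrime
    _ ≤ q.height := hle
    _ = Order.coheight Q := by rw [← idealHeight_eq_coheight]
    _ = Order.coheight v := by rw [← h2, ← h1]
    _ ≤ _ := Order.coheight_le_krullDim _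

/-- A morphism locally of finite type is quasi-finite at the points of its discrete fibres. -/
theorem quasiFiniteAt_of_isDiscrete_preimage {X Y : Scheme} (h : X ⟶ Y) [LocallyOfFiniteType h]
    {x : X} (hd : _root_.IsDiscrete (h ⁻¹' {h x})) : h.QuasiFiniteAt x := by
  have : DiscreteTopology (h ⁻¹' {h x}) := hd.to_subtype
  have : DiscreteTopology (h.fiber (h x)) := (h.fiberHomeo (h x)).isEmbedding.discreteTopology
  exact Scheme.Hom.quasiFiniteAt_iff_isOpen_singleton_asFiber.mpr (isOpen_discrete _)

/-- A surjective morphism from a proper irreducible scheme to a scheme of smaller dimension stays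
surjective on the complement of any affine open. -/
theorem image_compl_eq_univ_of_isAffineOpen {K : Type} [Field K] {X Y : Scheme}
    (sX : X ⟶ Spec (CommRingCat.of K)) (sY : Y ⟶ Spec (CommRingCat.of K)) [IsProper sX]
    [IrreducibleSpace X] [LocallyOfFiniteType sY] [QuasiCompact sY]
    (hdim : topologicalKrullDim Y < topologicalKrullDim X) (h : X ⟶ Y) (hh : h ≫ sY = sX)
    (h_surj : Function.Surjective h) {U : X.Opens} (hU : IsAffineOpen U) :
    h '' (U : Set X)ᶜ = Set.univ := by
  have : IsLocallyNoetherian X := LocallyOfFiniteType.isLocallyNoetherian sX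
  have : IsLocallyNoetherian Y := LocallyOfFiniteType.isLocallyNoetherian sY
  have : CompactSpace X := QuasiCompact.compactSpace_of_compactSpace sX
  have : CompactSpace Y := QuasiCompact.compactSpace_of_compactSpace sY
  have : IsNoetherian X := {}
  have : IsNoetherian Y := {}
  have : JacobsonSpace Y := LocallyOfFiniteType.jacobsonSpace sY
  have : LocallyOfFiniteType (h ≫ sY) := hh ▸ inferInstance
  have : LocallyOfFiniteType h := locallyOfFiniteType_of_comp h sY
  have : LocallyOfFinitePresentation h := inferInstance
  by_contra h_ne
  have h_constr : IsConstructible (h '' (U : Set X)ᶜ)ᶜ :=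
    (h.isConstructible_image (hU.isCompact.isConstructible U.isOpen).compl).compl
  obtain ⟨y, hyH, hy⟩ := nonempty_inter_closedPoints_of_isConstructible h_constr
    (Set.nonempty_compl.mpr h_ne)
  obtain ⟨x, rfl⟩ := h_surj y
  have hd := isDiscrete_of_isClosed_of_subset_affineOpen sX hU
    (F := h ⁻¹' {h x}) (IsClosed.preimage h.continuous hy) fun z hz ↦ by
      by_contra hzU
      exact hyH ⟨z, hzU, hz⟩
  have hx : x ∈ h.quasiFiniteLocus := quasiFiniteAt_of_isDiscrete_preimage h hd
  exact hdim.not_ge ((topologicalKrullDim_le_of_nonempty_opens sX _ ⟨x, hx⟩).trans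
    (topologicalKrullDim_le_of_locallyQuasiFinite (h.quasiFiniteLocus.ι ≫ h)))

/-- Lemma 6.4. Let `X` be an irreducible complete algebraic variety
over an algebraically closed field `K`. Then there exists a proper closed subset
`H ⊊ X` such that `h(H) = Y` for every surjective `K`-scheme morphism `h : X → Y` onto
a `K`-algebraic variety `Y` with `dim Y < dim X`. -/
theorem exists_proper_closed_surjecting_onto_smaller
    (K : Type) [Field K] [IsAlgClosed K] (X : Scheme)
    (sX : X ⟶ SpecK K)
    (hXft : LocallyOfFiniteType sX) (hXqc : QuasiCompact sX)
    (hirr : IrreducibleSpace X) (hcomplete : IsProper sX) :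
    ∃ H : Set X, IsClosed H ∧ H ≠ Set.univ ∧
      ∀ (Y : Scheme) (sY : Y ⟶ SpecK K),
        LocallyOfFiniteType sY → QuasiCompact sY →
        topologicalKrullDim Y < topologicalKrullDim X →
        ∀ h : X ⟶ Y, h ≫ sY = sX → Function.Surjective h.base →
          h.base '' H = Set.univ := by
  obtain ⟨x⟩ := hirr.toNonempty
  obtain ⟨U, hU, hxU, -⟩ := exists_isAffineOpen_mem_and_subset (U := ⊤) (x := x) trivial
  exact ⟨(U : Set X)ᶜ, U.isOpen.isClosed_compl, fun h ↦ (h ▸ Set.mem_univ x : x ∈ (U : Set X)ᶜ) hxU,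
    fun Y sY _ _ hdim h hh h_surj ↦ image_compl_eq_univ_of_isAffineOpen sX sY hdim h hh h_surj hU⟩

end GOE
end
end
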